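/- arXiv:2507.16105 — 3 statements merged into one kernel-verified Lean document; each statement's English description precedes it below -/
import Mathlib

section
/- (Matching Sunflower Lemma) There exists a universal constant c > 0 such that for all n ≥ 1, ℓ ≥ 1 and all ε with 0 < ε < 1/2: every family M of ℓ-matchings in K_{n,n} with |M| ≥ (c · ℓ · log²(ℓ/ε))^ℓ contains a subfamily M' ⊆ M with |M'| ≥ 2 which is an ε-matching sunflower. -/
/-- A matching in `K_{n,n}`: a set of edges with pairwise distinct left endpoints
and pairwise distinct right endpoints. -/
def IsMatching {n : ℕ} (M : Finset (Fin n × Fin n)) : Prop :=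
  ∀ e ∈ M, ∀ e' ∈ M, e ≠ e' → e.1 ≠ e'.1 ∧ e.2 ≠ e'.2

/-- A colouring of the vertices `L ⊕ R` of `K_{n,n}` with an odd number of `1`s. -/
def OddColouring {n : ℕ} (c : Fin n ⊕ Fin n → Bool) : Prop :=
  Odd (Nat.card {v : Fin n ⊕ Fin n // c v = true})

/-- A family `M'` of `ℓ`-matchings with `|M'| ≥ 2` and core `K = ⋂ M'` is an `ε`-matching
sunflower if for `c` sampled uniformly among colourings of `L ⊕ R` with an odd number of
vertices coloured 1, the probability that some `M ∈ M'` has every edge of `M \ K`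
monochromatic under `c` is at least `1 - ε`. -/
def IsMatchingSunflower (n : ℕ) (ε : ℝ) (𝓜' : Finset (Finset (Fin n × Fin n))) : Prop :=
  2 ≤ 𝓜'.card ∧
  1 - ε ≤
    (Nat.card {c : Fin n ⊕ Fin n → Bool // OddColouring c ∧
        ∃ M ∈ 𝓜', ∀ e ∈ M \ 𝓜'.inf id, c (Sum.inl e.1) = c (Sum.inr e.2)} : ℝ) /
      (Nat.card {c : Fin n ⊕ Fin n → Bool // OddColouring c} : ℝ)

open Finset

section BernoulliAverage

variable {X : Type*} [DecidableEq X]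

/-- The expectation of `g (W₀ ∪ W)`, where `W` contains each element of `s` independently with
probability `p`. -/
noncomputable def bernoulliAvg (p : ℝ) (s : Finset X) (g : Finset X → ℝ) (W₀ : Finset X) : ℝ :=
  ∑ W ∈ s.powerset, p ^ #W * (1 - p) ^ (#s - #W) * g (W₀ ∪ W)

lemma bernoulliAvg_empty (p : ℝ) (g : Finset X → ℝ) (W₀ : Finset X) :
    bernoulliAvg p ∅ g W₀ = g W₀ := by
  simp [bernoulliAvg]

lemma bernoulliAvg_insert (p : ℝ) {s : Finset X} {e : X} (he : e ∉ s) (g : Finset X → ℝ)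
    (W₀ : Finset X) :
    bernoulliAvg p (insert e s) g W₀ =
      (1 - p) * bernoulliAvg p s g W₀ + p * bernoulliAvg p s g (insert e W₀) := by
  simp only [bernoulliAvg]
  rw [Finset.sum_powerset_insert he, Finset.mul_sum, Finset.mul_sum]
  congr 1
  · refine Finset.sum_congr rfl fun W hW => ?_
    have hc := Finset.card_le_card (Finset.mem_powerset.1 hW)
    rw [Finset.card_insert_of_notMem he, Nat.sub_add_comm hc, pow_succ]
    ring
  · refine Finset.sum_congr rfl fun W hW => ?_
    have hW' := Finset.mem_powerset.1 hW
    rw [Finset.card_insert_of_notMem he, Finset.card_insert_of_notMem fun h => he (hW' h),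
      Nat.add_sub_add_right, pow_succ, Finset.union_insert, Finset.insert_union]
    ring

lemma bernoulliAvg_linear (p : ℝ) (s : Finset X) (a b : ℝ) (f g : Finset X → ℝ)
    (W₀ : Finset X) :
    bernoulliAvg p s (fun W => a * f W + b * g W) W₀ =
      a * bernoulliAvg p s f W₀ + b * bernoulliAvg p s g W₀ := by
  simp only [bernoulliAvg, Finset.mul_sum, ← Finset.sum_add_distrib]
  exact Finset.sum_congr rfl fun W _ => by ring

lemma bernoulliAvg_mono {p : ℝ} (hp : 0 ≤ p) (hp1 : p ≤ 1) (s : Finset X)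
    {f g : Finset X → ℝ} {W₀ W₁ : Finset X} (h : ∀ W, f (W₀ ∪ W) ≤ g (W₁ ∪ W)) :
    bernoulliAvg p s f W₀ ≤ bernoulliAvg p s g W₁ := by
  have := sub_nonneg.2 hp1
  exact Finset.sum_le_sum fun W _ => mul_le_mul_of_nonneg_left (h W) (by positivity)

lemma bernoulliAvg_insert_arg (p : ℝ) (s : Finset X) (g : Finset X → ℝ) (e : X)
    (W₀ : Finset X) :
    bernoulliAvg p s (fun W => g (insert e W)) W₀ = bernoulliAvg p s g (insert e W₀) := by
  simp [bernoulliAvg, Finset.insert_union]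

lemma bernoulliAvg_const (p : ℝ) (s : Finset X) (a : ℝ) (W₀ : Finset X) :
    bernoulliAvg p s (fun _ => a) W₀ = a := by
  induction s using Finset.induction_on generalizing W₀ with
  | empty => exact bernoulliAvg_empty ..
  | insert e s he ih => rw [bernoulliAvg_insert p he, ih, ih]; ring

/-- Two independent rounds of sampling amount to one round with a larger probability. -/
lemma bernoulliAvg_comp (p q : ℝ) (s : Finset X) (g : Finset X → ℝ) (W₀ : Finset X) :
    bernoulliAvg p s (bernoulliAvg q s g) W₀ =
      bernoulliAvg (1 - (1 - p) * (1 - q)) s g W₀ := by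
  induction s using Finset.induction_on generalizing W₀ with
  | empty => simp [bernoulliAvg_empty]
  | insert e s he ih =>
    have hq : bernoulliAvg q (insert e s) g = fun W =>
        (1 - q) * bernoulliAvg q s g W + q * (fun W => bernoulliAvg q s g (insert e W)) W :=
      funext fun W => bernoulliAvg_insert q he g W
    rw [bernoulliAvg_insert p he, bernoulliAvg_insert _ he, hq, bernoulliAvg_linear,
      bernoulliAvg_linear, bernoulliAvg_insert_arg p s (bernoulliAvg q s g),
      bernoulliAvg_insert_arg p s (bernoulliAvg q s g), Finset.insert_idem, ih, ih]
    ring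

end BernoulliAverage

section Spread

variable {X ι : Type*} [DecidableEq X]

/-- The indicator of the event that `W` contains no member of the indexed family `A`. -/
noncomputable def missIndicator (I : Finset ι) (A : ι → Finset X) (W : Finset X) : ℝ :=
  if ∃ i ∈ I, A i ⊆ W then 0 else 1

lemma missIndicator_le_one (I : Finset ι) (A : ι → Finset X) (W : Finset X) :
    missIndicator I A W ≤ 1 := by
  unfold missIndicator; split_ifs <;> norm_num

lemma missIndicator_nonneg (I : Finset ι) (A : ι → Finset X) (W : Finset X) :
    0 ≤ missIndicator I A W := by
  unfold missIndicator; split_ifs <;> norm_num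

lemma missIndicator_le {ι' : Type*} {I : Finset ι} {J : Finset ι'} {A : ι → Finset X}
    {B : ι' → Finset X} {W W' : Finset X}
    (h : ∀ j ∈ J, B j ⊆ W' → ∃ i ∈ I, A i ⊆ W) :
    missIndicator I A W ≤ missIndicator J B W' := by
  unfold missIndicator
  split_ifs with h₁ h₂ h₂ <;> try norm_num
  obtain ⟨j, hj, hjW⟩ := h₂
  exact h₁ (h j hj hjW)

/-- `T` assigns to each index `i` a part of `A i \ W` which together with `W` contains a member of
the family, of the least possible size. -/
structure IsMinRemainder (I : Finset ι) (A : ι → Finset X) (W : Finset X)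
    (T : ι → Finset X) : Prop where
  subset : ∀ i ∈ I, T i ⊆ A i
  disjoint : ∀ i ∈ I, Disjoint (T i) W
  exists_subset : ∀ i ∈ I, ∃ j ∈ I, A j ⊆ W ∪ T i
  subset_of_subset : ∀ i ∈ I, ∀ j ∈ I, A j ⊆ W ∪ T i → T i ⊆ A j

lemma exists_isMinRemainder (I : Finset ι) (A : ι → Finset X) (W : Finset X) :
    ∃ T, IsMinRemainder I A W T := by
  classical
  have key : ∀ i ∈ I, ∃ j ∈ I, A j ⊆ W ∪ A i ∧
      ∀ j' ∈ I, A j' ⊆ W ∪ A i → #(A j \ W) ≤ #(A j' \ W) := by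
    intro i hi
    obtain ⟨j, hj, hmin⟩ := Finset.exists_min_image (I.filter fun j => A j ⊆ W ∪ A i)
      (fun j => #(A j \ W)) ⟨i, by simp [hi]⟩
    rw [Finset.mem_filter] at hj
    exact ⟨j, hj.1, hj.2, fun j' hj' h => hmin j' (Finset.mem_filter.2 ⟨hj', h⟩)⟩
  choose! r hrI hrA hrmin using key
  have hsub : ∀ i ∈ I, A (r i) \ W ⊆ A i := fun i hi x hx => by
    rw [Finset.mem_sdiff] at hx
    exact (Finset.mem_union.1 (hrA i hi hx.1)).resolve_left hx.2
  refine ⟨fun i => A (r i) \ W, hsub, fun i _ => Finset.sdiff_disjoint,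
    fun i hi => ⟨r i, hrI i hi, ?_⟩, fun i hi j hj hjW => ?_⟩
  · rw [Finset.union_sdiff_self_eq_union]; exact Finset.subset_union_right
  · have hle := hrmin i hi j hj (hjW.trans (Finset.union_subset_union_right (hsub i hi)))
    have hs : A j \ W ⊆ A (r i) \ W := fun x hx => by
      rw [Finset.mem_sdiff] at hx
      exact (Finset.mem_union.1 (hjW hx.1)).resolve_left hx.2
    rw [← Finset.eq_of_subset_of_card_le hs hle]
    exact Finset.sdiff_subset


lemma bernoulliWeight_sdiff_le {p : ℝ} (hp : 0 < p) (hp1 : p ≤ 1) [Fintype X]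
    {Z Q : Finset X} (hQ : Q ⊆ Z) :
    p ^ #(Z \ Q) * (1 - p) ^ (#(univ : Finset X) - #(Z \ Q)) ≤
      p ^ #Z * (1 - p) ^ (#(univ : Finset X) - #Z) * (1 / p) ^ #Q := by
  have hc := Finset.card_sdiff_add_card_eq_card hQ
  have hZ := Finset.card_le_univ Z
  have h1 : 0 ≤ 1 - p := sub_nonneg.2 hp1
  have h2 : p ^ #Z * (1 / p) ^ #Q = p ^ #(Z \ Q) := by
    rw [← hc, pow_add, mul_assoc, ← mul_pow, mul_one_div_cancel hp.ne', one_pow, mul_one]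
  rw [mul_right_comm, h2]
  refine mul_le_mul_of_nonneg_left ?_ (by positivity)
  exact pow_le_pow_of_le_one h1 (by linarith) (by omega)

/-- If the family is spread, then few of its minimal remainders are large on average. -/
lemma sum_card_large_remainder_le [Fintype X] {I : Finset ι} {A : ι → Finset X} {p κ N : ℝ}
    (hp : 0 < p) (hp1 : p ≤ 1) (hκ : 0 < κ) (hpκ : 1 ≤ p * κ) (hN : 0 ≤ N) {K h : ℕ}
    (hh : 1 ≤ h) (hA : ∀ i ∈ I, #(A i) ≤ K)
    (hspread : ∀ Q : Finset X, Q.Nonempty → (#{i ∈ I | Q ⊆ A i} : ℝ) * κ ^ #Q ≤ N)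
    {T : Finset X → ι → Finset X} (hT : ∀ W, IsMinRemainder I A W (T W)) :
    ∑ W : Finset X, p ^ #W * (1 - p) ^ (#(univ : Finset X) - #W) *
      (#{i ∈ I | h ≤ #(T W i)} : ℝ) ≤ N * 2 ^ K / (p * κ) ^ h := by
  classical
  set μ : Finset X → ℝ := fun W => p ^ #W * (1 - p) ^ (#(univ : Finset X) - #W) with hμ
  have h1p : 0 ≤ 1 - p := sub_nonneg.2 hp1
  have hμ0 : ∀ W, 0 ≤ μ W := fun W => by positivity
  have hφ : ∀ Z : Finset X, ∃ B : Finset X, #B ≤ K ∧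
      ∀ j ∈ I, A j ⊆ Z → ∃ j' ∈ I, B = A j' ∧ A j' ⊆ Z := by
    intro Z
    by_cases hZ : ∃ j ∈ I, A j ⊆ Z
    · obtain ⟨j, hj, hjZ⟩ := hZ
      exact ⟨A j, hA j hj, fun _ _ _ => ⟨j, hj, rfl, hjZ⟩⟩
    · exact ⟨∅, by simp, fun j hj hjZ => (hZ ⟨j, hj, hjZ⟩).elim⟩
  choose φ hφK hφ using hφ
  set S : Finset (Finset X × ι) := {x ∈ univ ×ˢ I | h ≤ #(T x.1 x.2)} with hS
  set R : Finset (Finset X × Finset X × ι) :=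
    {y ∈ univ ×ˢ (univ ×ˢ I) |
      (y.2.1 ⊆ φ y.1 ∧ y.2.1 ⊆ y.1 ∧ h ≤ #y.2.1) ∧ y.2.1 ⊆ A y.2.2} with hR
  have hL : ∑ W : Finset X, μ W * (#{i ∈ I | h ≤ #(T W i)} : ℝ) = ∑ x ∈ S, μ x.1 := by
    rw [hS, Finset.sum_filter, Finset.sum_product]
    refine Finset.sum_congr rfl fun W _ => ?_
    dsimp only
    rw [← Finset.sum_filter, Finset.sum_const, nsmul_eq_mul, mul_comm]
  let enc : Finset X × ι → Finset X × Finset X × ι :=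
    fun x => (x.1 ∪ T x.1 x.2, T x.1 x.2, x.2)
  have hdec : ∀ x ∈ S, (x.1 ∪ T x.1 x.2) \ T x.1 x.2 = x.1 := by
    intro x hx
    simp only [hS, Finset.mem_filter, Finset.mem_product] at hx
    exact Finset.union_sdiff_cancel_right ((hT x.1).disjoint x.2 hx.1.2).symm
  have hinj : Set.InjOn enc S := by
    intro x hx y hy hxy
    simp only [enc, Prod.mk.injEq] at hxy
    refine Prod.ext ?_ hxy.2.2
    rw [← hdec x hx, ← hdec y hy, hxy.1, hxy.2.1]
  have hmaps : S.image enc ⊆ R := by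
    intro y hy
    obtain ⟨x, hx, rfl⟩ := Finset.mem_image.1 hy
    simp only [hS, Finset.mem_filter, Finset.mem_product] at hx
    have hTx := hT x.1
    obtain ⟨j, hj, hjW⟩ := hTx.exists_subset x.2 hx.1.2
    obtain ⟨j', hj', hB, hj'W⟩ := hφ _ j hj hjW
    simp only [hR, enc, Finset.mem_filter, Finset.mem_product, Finset.mem_univ, true_and]
    refine ⟨hx.1.2, ⟨?_, Finset.subset_union_right, hx.2⟩, hTx.subset _ hx.1.2⟩
    rw [hB]
    exact hTx.subset_of_subset _ hx.1.2 _ hj' hj'W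
  have hstep : ∑ x ∈ S, μ x.1 ≤ ∑ y ∈ R, μ (y.1 \ y.2.1) := by
    calc ∑ x ∈ S, μ x.1 = ∑ y ∈ S.image enc, μ (y.1 \ y.2.1) := by
          rw [Finset.sum_image hinj]
          exact Finset.sum_congr rfl fun x hx => by simp only [enc]; rw [hdec x hx]
      _ ≤ _ := Finset.sum_le_sum_of_subset_of_nonneg hmaps fun y _ _ => hμ0 _
  have hRsum : ∑ y ∈ R, μ (y.1 \ y.2.1) =
      ∑ Z : Finset X, ∑ Q : Finset X, if Q ⊆ φ Z ∧ Q ⊆ Z ∧ h ≤ #Q then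
        (#{i ∈ I | Q ⊆ A i} : ℝ) * μ (Z \ Q) else 0 := by
    rw [hR, Finset.sum_filter, Finset.sum_product]
    refine Finset.sum_congr rfl fun Z _ => ?_
    rw [Finset.sum_product]
    refine Finset.sum_congr rfl fun Q _ => ?_
    split_ifs with hQ
    · simp only [hQ, true_and, and_self]
      rw [← Finset.sum_filter, Finset.sum_const, nsmul_eq_mul]
    · simp [hQ]
  rw [hL]
  refine hstep.trans (hRsum.le.trans ?_)
  have hinner : ∀ Z : Finset X, (∑ Q : Finset X, if Q ⊆ φ Z ∧ Q ⊆ Z ∧ h ≤ #Q then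
        (#{i ∈ I | Q ⊆ A i} : ℝ) * μ (Z \ Q) else 0) ≤
      μ Z * (N * 2 ^ K / (p * κ) ^ h) := by
    intro Z
    have hterm : ∀ Q : Finset X, (if Q ⊆ φ Z ∧ Q ⊆ Z ∧ h ≤ #Q then
        (#{i ∈ I | Q ⊆ A i} : ℝ) * μ (Z \ Q) else 0) ≤
        if Q ⊆ φ Z then μ Z * (N / (p * κ) ^ h) else 0 := by
      intro Q
      have hnn : 0 ≤ μ Z * (N / (p * κ) ^ h) := mul_nonneg (hμ0 Z) (by positivity)
      by_cases hQ : Q ⊆ φ Z ∧ Q ⊆ Z ∧ h ≤ #Q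
      · rw [if_pos hQ, if_pos hQ.1]
        have hne : Q.Nonempty := Finset.card_pos.1 (by omega)
        have hcount : (#{i ∈ I | Q ⊆ A i} : ℝ) ≤ N / κ ^ #Q := by
          rw [le_div_iff₀ (by positivity)]; exact hspread Q hne
        calc (#{i ∈ I | Q ⊆ A i} : ℝ) * μ (Z \ Q)
            ≤ (N / κ ^ #Q) * (μ Z * (1 / p) ^ #Q) :=
              mul_le_mul hcount (bernoulliWeight_sdiff_le hp hp1 hQ.2.1) (hμ0 _) (by positivity)
          _ = μ Z * (N / (p * κ) ^ #Q) := by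
              rw [one_div, inv_pow, mul_pow]; field_simp
          _ ≤ μ Z * (N / (p * κ) ^ h) := by
              refine mul_le_mul_of_nonneg_left ?_ (hμ0 Z)
              exact div_le_div_of_nonneg_left hN (by positivity)
                (pow_le_pow_right₀ hpκ hQ.2.2)
      · rw [if_neg hQ]; split_ifs <;> simp [hnn]
    refine (Finset.sum_le_sum fun Q _ => hterm Q).trans ?_
    rw [← Finset.sum_filter, Finset.sum_const, nsmul_eq_mul]
    have hcard : (#{Q : Finset X | Q ⊆ φ Z} : ℝ) ≤ 2 ^ K := by
      have : ({Q : Finset X | Q ⊆ φ Z} : Finset (Finset X)) = (φ Z).powerset := by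
        ext Q; simp
      rw [this, Finset.card_powerset]
      exact_mod_cast Nat.pow_le_pow_right (by norm_num) (hφK Z)
    have hnn : 0 ≤ μ Z * (N / (p * κ) ^ h) := mul_nonneg (hμ0 Z) (by positivity)
    calc _ ≤ 2 ^ K * (μ Z * (N / (p * κ) ^ h)) := mul_le_mul_of_nonneg_right hcard hnn
      _ = _ := by ring
  refine (Finset.sum_le_sum fun Z _ => hinner Z).trans ?_
  rw [← Finset.sum_mul]
  have hone : ∑ Z : Finset X, μ Z = 1 := by
    have := Finset.sum_pow_mul_eq_add_pow p (1 - p) (univ : Finset X)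
    rw [Finset.powerset_univ] at this
    rw [this]; simp
  rw [hone, one_mul]

/-- A random set obtained by `m` rounds of sampling misses a spread family of sets of size less than
`2 ^ j` with probability at most `4 ^ j / 2 ^ m`. -/
theorem bernoulliAvg_missIndicator_le [Fintype X] {p κ N : ℝ} (hp : 0 < p) (hp1 : p ≤ 1)
    (hpκ : p * κ = 32) (hN : 0 < N) (m : ℕ) :
    ∀ (j : ℕ) (I : Finset ι) (A : ι → Finset X), (∀ i ∈ I, #(A i) < 2 ^ j) →
      (∀ Q : Finset X, Q.Nonempty → (#{i ∈ I | Q ⊆ A i} : ℝ) * κ ^ #Q ≤ N) →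
      (1 - 1 / 2 ^ j) * N < #I →
      bernoulliAvg (1 - (1 - p) ^ m) univ (missIndicator I A) ∅ ≤ 4 ^ j / 2 ^ m := by
  have hκ : 0 < κ := pos_of_mul_pos_right (by rw [hpκ]; norm_num) hp.le
  have h1p : 0 ≤ 1 - p := sub_nonneg.2 hp1
  have hq0 : ∀ m : ℕ, 0 ≤ 1 - (1 - p) ^ m := fun m =>
    sub_nonneg.2 (pow_le_one₀ h1p (by linarith))
  have hq1 : ∀ m : ℕ, 1 - (1 - p) ^ m ≤ 1 := fun m => by
    have := pow_nonneg h1p m; linarith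
  induction m with
  | zero =>
    intro j I A _ _ _
    calc _ ≤ bernoulliAvg (1 - (1 - p) ^ 0) univ (fun _ => (1 : ℝ)) (∅ : Finset X) :=
          bernoulliAvg_mono (hq0 0) (hq1 0) _ fun W => missIndicator_le_one ..
      _ = 1 := bernoulliAvg_const ..
      _ ≤ _ := by simpa using one_le_pow₀ (by norm_num : (1 : ℝ) ≤ 4)
  | succ m ih =>
    intro j I A hA hspread hI
    rcases j with _ | j
    · have hI0 : 0 < #I := by exact_mod_cast (by simpa using hI : (0 : ℝ) < #I)
      obtain ⟨i, hi⟩ := Finset.card_pos.1 hI0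
      have hAi : A i = ∅ := by simpa using hA i hi
      calc _ ≤ bernoulliAvg (1 - (1 - p) ^ (m + 1)) univ (fun _ => (0 : ℝ)) (∅ : Finset X) :=
            bernoulliAvg_mono (hq0 _) (hq1 _) _ fun W => by
              unfold missIndicator
              rw [if_pos ⟨i, hi, by simp [hAi]⟩]
        _ = 0 := bernoulliAvg_const ..
        _ ≤ _ := by positivity
    have hcomp : bernoulliAvg (1 - (1 - p) ^ (m + 1)) univ (missIndicator I A) ∅ =
        bernoulliAvg p univ (bernoulliAvg (1 - (1 - p) ^ m) univ (missIndicator I A)) ∅ := by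
      rw [bernoulliAvg_comp]; congr 1; ring
    rw [hcomp]
    choose T hT using exists_isMinRemainder I A
    have hbad := sum_card_large_remainder_le (K := 2 ^ (j + 1)) (h := 2 ^ j) hp hp1 hκ
      (by rw [hpκ]; norm_num) hN.le Nat.one_le_two_pow (fun i hi => (hA i hi).le) hspread hT
    have hpoint : ∀ W : Finset X,
        bernoulliAvg (1 - (1 - p) ^ m) univ (missIndicator I A) W ≤
          4 ^ j / 2 ^ m + 4 ^ (j + 1) / 2 ^ m * (2 ^ (j + 1) / N) *
            #{i ∈ I | 2 ^ j ≤ #(T W i)} := by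
      intro W
      by_cases hW : (#{i ∈ I | 2 ^ j ≤ #(T W i)} : ℝ) < N / 2 ^ (j + 1)
      · have hgood := ih j {i ∈ I | ¬ 2 ^ j ≤ #(T W i)} (T W)
          (fun i hi => not_le.1 (Finset.mem_filter.1 hi).2)
          (fun Q hQ => by
            refine le_trans (mul_le_mul_of_nonneg_right ?_ (by positivity)) (hspread Q hQ)
            refine Nat.cast_le.2 (Finset.card_le_card fun i hi => ?_)
            simp only [Finset.mem_filter] at hi ⊢
            exact ⟨hi.1.1, hi.2.trans ((hT W).subset i hi.1.1)⟩)
          (by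
            have hsum : (#{i ∈ I | 2 ^ j ≤ #(T W i)} : ℝ) + #{i ∈ I | ¬ 2 ^ j ≤ #(T W i)} = #I := by
              exact_mod_cast Finset.card_filter_add_card_filter_not (s := I) _
            have h2 : N / 2 ^ j = 2 * (N / 2 ^ (j + 1)) := by rw [pow_succ]; field_simp
            have h3 : (1 - 1 / 2 ^ j) * N = N - N / 2 ^ j := by ring
            have h4 : (1 - 1 / 2 ^ (j + 1)) * N = N - N / 2 ^ (j + 1) := by ring
            rw [h3]; rw [h4] at hI
            linarith)
        have hmono : bernoulliAvg (1 - (1 - p) ^ m) univ (missIndicator I A) W ≤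
            bernoulliAvg (1 - (1 - p) ^ m) univ
              (missIndicator {i ∈ I | ¬ 2 ^ j ≤ #(T W i)} (T W)) ∅ := by
          refine bernoulliAvg_mono (hq0 m) (hq1 m) _ fun W' => missIndicator_le ?_
          intro i hi hiW
          have hi' := (Finset.mem_filter.1 hi).1
          obtain ⟨k, hk, hkW⟩ := (hT W).exists_subset i hi'
          rw [Finset.empty_union] at hiW
          exact ⟨k, hk, hkW.trans (Finset.union_subset_union_right hiW)⟩
        have hnn : (0 : ℝ) ≤ 4 ^ (j + 1) / 2 ^ m * (2 ^ (j + 1) / N) *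
            #{i ∈ I | 2 ^ j ≤ #(T W i)} := by positivity
        linarith
      · have hsame := ih (j + 1) I A hA hspread hI
        have hmono : bernoulliAvg (1 - (1 - p) ^ m) univ (missIndicator I A) W ≤
            bernoulliAvg (1 - (1 - p) ^ m) univ (missIndicator I A) ∅ :=
          bernoulliAvg_mono (hq0 m) (hq1 m) _ fun W' => missIndicator_le fun i hi hiW =>
            ⟨i, hi, hiW.trans (Finset.union_subset_union_left (Finset.empty_subset _))⟩
        have hge : 1 ≤ (2 ^ (j + 1) / N) * (#{i ∈ I | 2 ^ j ≤ #(T W i)} : ℝ) := by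
          have := not_lt.1 hW
          calc (1 : ℝ) = (2 ^ (j + 1) / N) * (N / 2 ^ (j + 1)) := by field_simp
            _ ≤ _ := mul_le_mul_of_nonneg_left this (by positivity)
        have hfin : (4 : ℝ) ^ (j + 1) / 2 ^ m ≤ 4 ^ (j + 1) / 2 ^ m * (2 ^ (j + 1) / N) *
            #{i ∈ I | 2 ^ j ≤ #(T W i)} := by
          rw [mul_assoc]
          exact le_mul_of_one_le_right (by positivity) hge
        have hnn : (0 : ℝ) ≤ 4 ^ j / 2 ^ m := by positivity
        linarith
    have hsmall : (2 : ℝ) ^ (j + 1) * (2 ^ 2 ^ (j + 1) / 32 ^ 2 ^ j) ≤ 1 / 4 := by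
      have hj : j + 3 ≤ 3 * 2 ^ j := by
        have := Nat.lt_two_pow_self (n := j)
        omega
      have e1 : (2 : ℝ) ^ 2 ^ (j + 1) / 32 ^ 2 ^ j = 1 / 2 ^ (3 * 2 ^ j) := by
        rw [show (32 : ℝ) = 2 ^ 5 by norm_num, ← pow_mul,
          div_eq_div_iff (by positivity) (by positivity), ← pow_add, one_mul]
        congr 1; ring
      rw [e1, mul_one_div, div_le_div_iff₀ (by positivity) (by norm_num), one_mul,
        show (2 : ℝ) ^ (j + 1) * 4 = 2 ^ (j + 3) by ring]
      exact pow_le_pow_right₀ (by norm_num) hj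
    rw [hpκ] at hbad
    calc bernoulliAvg p univ (bernoulliAvg (1 - (1 - p) ^ m) univ (missIndicator I A)) ∅
        ≤ bernoulliAvg p univ (fun W => 4 ^ j / 2 ^ m * (fun _ => (1 : ℝ)) W +
            4 ^ (j + 1) / 2 ^ m * (2 ^ (j + 1) / N) *
              (fun W => (#{i ∈ I | 2 ^ j ≤ #(T W i)} : ℝ)) W) ∅ :=
          bernoulliAvg_mono hp.le hp1 _ fun W => by simpa using hpoint W
      _ = 4 ^ j / 2 ^ m + 4 ^ (j + 1) / 2 ^ m * (2 ^ (j + 1) / N) *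
            bernoulliAvg p univ (fun W => (#{i ∈ I | 2 ^ j ≤ #(T W i)} : ℝ)) ∅ := by
          rw [bernoulliAvg_linear, bernoulliAvg_const, mul_one]
      _ ≤ 4 ^ j / 2 ^ m + 4 ^ (j + 1) / 2 ^ m * (2 ^ (j + 1) / N) *
            (N * 2 ^ 2 ^ (j + 1) / 32 ^ 2 ^ j) := by
          gcongr
          simpa [bernoulliAvg] using hbad
      _ = 4 ^ j / 2 ^ m + 4 ^ (j + 1) / 2 ^ m *
            (2 ^ (j + 1) * (2 ^ 2 ^ (j + 1) / 32 ^ 2 ^ j)) := by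
          field_simp
      _ ≤ 4 ^ j / 2 ^ m + 4 ^ (j + 1) / 2 ^ m * (1 / 4) := by gcongr
      _ = _ := by rw [pow_succ, pow_succ]; field_simp; norm_num

end Spread

section Assignment

variable {V : Type*} [DecidableEq V]

/-- The literals on the variables in `s` that hold when exactly the variables in `R` are true. -/
def literals (s R : Finset V) : Finset (V × Bool) :=
  s.image fun v => (v, decide (v ∈ R))

/-- The expectation of `g (W₀ ∪ W)`, where `W` is the set of literals that hold under a uniform
assignment of the variables in `s`. -/
noncomputable def assignAvg (s : Finset V) (g : Finset (V × Bool) → ℝ)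
    (W₀ : Finset (V × Bool)) : ℝ :=
  (∑ R ∈ s.powerset, g (W₀ ∪ literals s R)) / 2 ^ #s

lemma assignAvg_linear (s : Finset V) (a b : ℝ) (f g : Finset (V × Bool) → ℝ)
    (W₀ : Finset (V × Bool)) :
    assignAvg s (fun W => a * f W + b * g W) W₀ =
      a * assignAvg s f W₀ + b * assignAvg s g W₀ := by
  simp only [assignAvg, Finset.sum_add_distrib, ← Finset.mul_sum]
  ring

lemma assignAvg_mono (s : Finset V) {f g : Finset (V × Bool) → ℝ} (h : ∀ W, f W ≤ g W)
    (W₀ : Finset (V × Bool)) : assignAvg s f W₀ ≤ assignAvg s g W₀ := by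
  unfold assignAvg
  gcongr
  exact h _

lemma assignAvg_insert_arg (s : Finset V) (g : Finset (V × Bool) → ℝ) (e : V × Bool)
    (W₀ : Finset (V × Bool)) :
    assignAvg s (fun W => g (insert e W)) W₀ = assignAvg s g (insert e W₀) := by
  simp [assignAvg, Finset.insert_union]

lemma literals_insert {s R : Finset V} {v : V} (hv : v ∉ s) (hR : R ⊆ s) :
    literals (insert v s) R = insert (v, false) (literals s R) := by
  have : v ∉ R := fun h => hv (hR h)
  simp [literals, Finset.image_insert, this]

lemma literals_insert_insert {s R : Finset V} {v : V} (hv : v ∉ s) :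
    literals (insert v s) (insert v R) = insert (v, true) (literals s R) := by
  simp only [literals, Finset.image_insert, Finset.mem_insert_self, decide_true]
  congr 1
  refine Finset.image_congr fun w hw => ?_
  have : w ≠ v := fun h => hv (h ▸ hw)
  simp [this]

lemma assignAvg_insert {s : Finset V} {v : V} (hv : v ∉ s) (g : Finset (V × Bool) → ℝ)
    (W₀ : Finset (V × Bool)) :
    assignAvg (insert v s) g W₀ =
      1 / 2 * assignAvg s g (insert (v, false) W₀) +
        1 / 2 * assignAvg s g (insert (v, true) W₀) := by
  simp only [assignAvg]
  rw [Finset.sum_powerset_insert hv, Finset.card_insert_of_notMem hv, pow_succ, add_div]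
  congr 1
  · rw [Finset.sum_congr rfl fun R hR => by
      rw [literals_insert hv (Finset.mem_powerset.1 hR), Finset.union_insert,
        ← Finset.insert_union]]
    field_simp
  · rw [Finset.sum_congr rfl fun R _ => by
      rw [literals_insert_insert hv, Finset.union_insert, ← Finset.insert_union]]
    field_simp

/-- If the sampling inequality holds variable by variable, then a uniform assignment gives a smaller
expectation than a set of independently sampled literals. -/
lemma assignAvg_le_bernoulliAvg {q : ℝ} (hq : 0 ≤ q) (hq1 : q ≤ 1)
    {f : Finset (V × Bool) → ℝ}
    (hf : ∀ W v, 1 / 2 * f (insert (v, false) W) + 1 / 2 * f (insert (v, true) W) ≤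
      (1 - q) * ((1 - q) * f W + q * f (insert (v, false) W)) +
        q * ((1 - q) * f (insert (v, true) W) +
          q * f (insert (v, false) (insert (v, true) W))))
    (s : Finset V) (W₀ : Finset (V × Bool)) :
    assignAvg s f W₀ ≤ bernoulliAvg q (s ×ˢ univ) f W₀ := by
  have h1 : 0 ≤ 1 - q := sub_nonneg.2 hq1
  induction s using Finset.induction_on generalizing W₀ with
  | empty => simp [assignAvg, bernoulliAvg, literals]
  | insert v s hv ih =>
    have hprod : (insert v s) ×ˢ (univ : Finset Bool) =
        insert (v, true) (insert (v, false) (s ×ˢ univ)) := by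
      ext ⟨w, b⟩
      cases b <;> simp
    rw [hprod, bernoulliAvg_insert q (by simp [hv]), bernoulliAvg_insert q (by simp [hv]),
      bernoulliAvg_insert q (by simp [hv])]
    calc assignAvg (insert v s) f W₀
        = assignAvg s (fun W => 1 / 2 * (fun W => f (insert (v, false) W)) W +
            1 / 2 * (fun W => f (insert (v, true) W)) W) W₀ := by
          rw [assignAvg_linear, assignAvg_insert_arg s f, assignAvg_insert_arg s f,
            assignAvg_insert hv]
      _ ≤ assignAvg s (fun W =>
            (1 - q) * (fun W => (1 - q) * f W + q * (fun W => f (insert (v, false) W)) W) W +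
            q * (fun W => (1 - q) * (fun W => f (insert (v, true) W)) W +
              q * (fun W => f (insert (v, false) (insert (v, true) W))) W) W) W₀ :=
          assignAvg_mono s (fun W => hf W v) W₀
      _ = (1 - q) * ((1 - q) * assignAvg s f W₀ + q * assignAvg s f (insert (v, false) W₀)) +
            q * ((1 - q) * assignAvg s f (insert (v, true) W₀) +
              q * assignAvg s f (insert (v, false) (insert (v, true) W₀))) := by
          rw [assignAvg_linear, assignAvg_linear, assignAvg_linear, assignAvg_insert_arg s f,
            assignAvg_insert_arg s f, ← assignAvg_insert_arg s f (v, false) (insert (v, true) W₀),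
            ← assignAvg_insert_arg s (fun W => f (insert (v, false) W)) (v, true) W₀]
      _ ≤ _ := by
          gcongr <;> exact ih _

lemma missIndicator_literal_inequality {ι : Type*} {I : Finset ι}
    {A : ι → Finset (V × Bool)}
    (hA : ∀ i ∈ I, ∀ v, (v, false) ∈ A i → (v, true) ∉ A i) {q : ℝ}
    (hq2 : q ≤ 1 / 2) (W : Finset (V × Bool)) (v : V) :
    1 / 2 * missIndicator I A (insert (v, false) W) +
        1 / 2 * missIndicator I A (insert (v, true) W) ≤
      (1 - q) * ((1 - q) * missIndicator I A W + q * missIndicator I A (insert (v, false) W)) +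
        q * ((1 - q) * missIndicator I A (insert (v, true) W) +
          q * missIndicator I A (insert (v, false) (insert (v, true) W))) := by
  have ha : ∀ e, missIndicator I A (insert e W) ≤ missIndicator I A W := fun e =>
    missIndicator_le fun i hi hiW => ⟨i, hi, hiW.trans (Finset.subset_insert e W)⟩
  have hd0 := missIndicator_nonneg I A (insert (v, false) (insert (v, true) W))
  have hzero_or_one : ∀ W, missIndicator I A W = 0 ∨ missIndicator I A W = 1 := fun W => by
    unfold missIndicator; split_ifs <;> simp
  have hboth : missIndicator I A (insert (v, false) W) = 1 →
      missIndicator I A (insert (v, true) W) = 1 →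
      missIndicator I A (insert (v, false) (insert (v, true) W)) = 1 := by
    simp only [missIndicator, ite_eq_right_iff, zero_ne_one, imp_false, not_exists, not_and]
    intro h₁ h₂ i hi hiW
    by_cases hf : (v, false) ∈ A i
    · refine h₁ i hi fun x hx => ?_
      have hne : x ≠ (v, true) := fun h => hA i hi v hf (h ▸ hx)
      have := hiW hx
      simp only [Finset.mem_insert] at this ⊢
      tauto
    · refine h₂ i hi fun x hx => ?_
      have hne : x ≠ (v, false) := fun h => hf (h ▸ hx)
      have := hiW hx
      simp only [Finset.mem_insert] at this ⊢
      tauto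
  have haf := ha (v, false)
  have hat := ha (v, true)
  have ha0 := missIndicator_nonneg I A W
  generalize missIndicator I A (insert (v, false) (insert (v, true) W)) = d at *
  have hq1 : 0 ≤ (1 - q) * (1 - q) := mul_self_nonneg _
  have hqq : 0 ≤ q * q := mul_self_nonneg _
  rcases hzero_or_one (insert (v, false) W) with hb | hb <;>
    rcases hzero_or_one (insert (v, true) W) with hc | hc <;>
    rw [hb] at haf ⊢ <;> rw [hc] at hat ⊢
  · nlinarith [mul_nonneg hq1 ha0, mul_nonneg hqq hd0]
  · nlinarith [mul_le_mul_of_nonneg_left hat hq1, mul_nonneg hqq hd0]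
  · nlinarith [mul_le_mul_of_nonneg_left haf hq1, mul_nonneg hqq hd0]
  · rw [hboth hb hc]
    nlinarith [mul_le_mul_of_nonneg_left hat hq1]

/-- A uniform assignment falsifies every term of a spread family of consistent terms with small
probability. -/
theorem assignAvg_missIndicator_le [Fintype V] {ι : Type*} {I : Finset ι} (hI : I.Nonempty)
    {A : ι → Finset (V × Bool)} {j m : ℕ} (hm : 1 ≤ m)
    (hA : ∀ i ∈ I, ∀ v, (v, false) ∈ A i → (v, true) ∉ A i)
    (hcard : ∀ i ∈ I, #(A i) < 2 ^ j)
    (hspread : ∀ Q : Finset (V × Bool), Q.Nonempty →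
      (#{i ∈ I | Q ⊆ A i} : ℝ) * (64 * m) ^ #Q ≤ #I) :
    assignAvg univ (missIndicator I A) ∅ ≤ 4 ^ j / 2 ^ m := by
  have hm0 : (1 : ℝ) ≤ m := by exact_mod_cast hm
  set p : ℝ := 1 / (2 * m) with hp
  have hp0 : 0 < p := by positivity
  have hmp : m * p = 1 / 2 := by rw [hp]; field_simp
  have hp1 : p ≤ 1 := by nlinarith
  have hN : (0 : ℝ) < #I := by exact_mod_cast Finset.card_pos.2 hI
  have hmain := bernoulliAvg_missIndicator_le hp0 hp1 (κ := 64 * m)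
    (by rw [hp]; field_simp; norm_num) hN m j I A hcard hspread
    (by
      have : (0 : ℝ) < 1 / 2 ^ j := by positivity
      nlinarith)
  have hbern : 1 - m * p ≤ (1 - p) ^ m := by
    have := one_add_mul_le_pow (a := -p) (by linarith) m
    rw [← sub_eq_add_neg] at this
    linarith
  have hq0 : 0 ≤ 1 - (1 - p) ^ m := sub_nonneg.2 (pow_le_one₀ (by linarith) (by linarith))
  have hq2 : 1 - (1 - p) ^ m ≤ 1 / 2 := by linarith
  refine le_trans ?_ hmain
  rw [← Finset.univ_product_univ]
  exact assignAvg_le_bernoulliAvg hq0 (by linarith)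
    (missIndicator_literal_inequality hA hq2) _ _

end Assignment

section Matching

variable {n : ℕ}

/-- The vertices covered by a set of edges. -/
def coveredVertices (M : Finset (Fin n × Fin n)) : Finset (Fin n ⊕ Fin n) :=
  M.image (fun e => Sum.inl e.1) ∪ M.image (fun e => Sum.inr e.2)

/-- The edges of `M` with both endpoints in `T`. -/
def edgesWithin (T : Finset (Fin n ⊕ Fin n)) (M : Finset (Fin n × Fin n)) :
    Finset (Fin n × Fin n) :=
  {e ∈ M | Sum.inl e.1 ∈ T ∧ Sum.inr e.2 ∈ T}

/-- The members of `𝓜` that cover `T` and whose edges within `T` form the set `N`. -/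
def vertexLink (𝓜 : Finset (Finset (Fin n × Fin n))) (T : Finset (Fin n ⊕ Fin n))
    (N : Finset (Fin n × Fin n)) : Finset (Finset (Fin n × Fin n)) :=
  {M ∈ 𝓜 | T ⊆ coveredVertices M ∧ edgesWithin T M = N}

/-- The edges within `insert v T` that are not within `T`. -/
def newEdges (T : Finset (Fin n ⊕ Fin n)) (v : Fin n ⊕ Fin n) : Finset (Fin n × Fin n) :=
  edgesWithin (insert v T) univ \ edgesWithin T univ

lemma inl_mem_coveredVertices {M : Finset (Fin n × Fin n)} {a : Fin n} :
    Sum.inl a ∈ coveredVertices M ↔ ∃ e ∈ M, e.1 = a := by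
  simp [coveredVertices]

lemma inr_mem_coveredVertices {M : Finset (Fin n × Fin n)} {b : Fin n} :
    Sum.inr b ∈ coveredVertices M ↔ ∃ e ∈ M, e.2 = b := by
  simp [coveredVertices]

lemma card_coveredVertices_le (M : Finset (Fin n × Fin n)) :
    #(coveredVertices M) ≤ 2 * #M := by
  refine (Finset.card_union_le _ _).trans ?_
  have h₁ := Finset.card_image_le (s := M) (f := fun e => (Sum.inl e.1 : Fin n ⊕ Fin n))
  have h₂ := Finset.card_image_le (s := M) (f := fun e => (Sum.inr e.2 : Fin n ⊕ Fin n))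
  omega

lemma endpoint_eq_of_mem_newEdges {T : Finset (Fin n ⊕ Fin n)} {v : Fin n ⊕ Fin n}
    {e : Fin n × Fin n} (he : e ∈ newEdges T v) :
    (Sum.inl e.1 = v ∧ Sum.inr e.2 ∈ T) ∨ (Sum.inl e.1 ∈ T ∧ Sum.inr e.2 = v) := by
  simp only [newEdges, edgesWithin, Finset.mem_sdiff, Finset.mem_filter, Finset.mem_univ,
    true_and, Finset.mem_insert] at he
  obtain ⟨⟨h₁ | h₁, h₂ | h₂⟩, h₃⟩ := he
  · exact absurd (h₁.trans h₂.symm) (by simp)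
  · exact Or.inl ⟨h₁, h₂⟩
  · exact Or.inr ⟨h₁, h₂⟩
  · exact absurd ⟨h₁, h₂⟩ h₃

lemma IsMatching.eq_of_mem_newEdges {M : Finset (Fin n × Fin n)} (hM : IsMatching M)
    {T : Finset (Fin n ⊕ Fin n)} {v : Fin n ⊕ Fin n} {e e' : Fin n × Fin n} (he : e ∈ M)
    (he' : e' ∈ M) (hv : e ∈ newEdges T v) (hv' : e' ∈ newEdges T v) : e = e' := by
  by_contra hne
  obtain ⟨h₁, h₂⟩ := hM e he e' he' hne
  rcases endpoint_eq_of_mem_newEdges hv with h | h <;>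
    rcases endpoint_eq_of_mem_newEdges hv' with h' | h'
  · exact h₁ (Sum.inl.inj (h.1.trans h'.1.symm))
  · exact absurd (h.1.trans h'.2.symm) (by simp)
  · exact absurd (h.2.trans h'.1.symm) (by simp)
  · exact h₂ (Sum.inr.inj (h.2.trans h'.2.symm))

lemma card_newEdges_le {T : Finset (Fin n ⊕ Fin n)} {M : Finset (Fin n × Fin n)}
    (hT : T ⊆ coveredVertices M) (v : Fin n ⊕ Fin n) : #(newEdges T v) ≤ #M := by
  rcases v with a | b
  · refine le_trans (Finset.card_le_card fun e he => ?_)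
      (Finset.card_image_le (s := M) (f := fun e => (a, e.2)))
    rcases endpoint_eq_of_mem_newEdges he with ⟨h₁, h₂⟩ | ⟨_, h₂⟩
    · obtain ⟨e', he', h⟩ := inr_mem_coveredVertices.1 (hT h₂)
      exact Finset.mem_image.2 ⟨e', he', Prod.ext (Sum.inl.inj h₁).symm h⟩
    · exact absurd h₂ (by simp)
  · refine le_trans (Finset.card_le_card fun e he => ?_)
      (Finset.card_image_le (s := M) (f := fun e => (e.1, b)))
    rcases endpoint_eq_of_mem_newEdges he with ⟨h₁, _⟩ | ⟨h₁, h₂⟩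
    · exact absurd h₁ (by simp)
    · obtain ⟨e', he', h⟩ := inl_mem_coveredVertices.1 (hT h₁)
      exact Finset.mem_image.2 ⟨e', he', Prod.ext h (Sum.inr.inj h₂).symm⟩

lemma IsMatching.edgesWithin_insert {M : Finset (Fin n × Fin n)} (hM : IsMatching M)
    (T : Finset (Fin n ⊕ Fin n)) (v : Fin n ⊕ Fin n) :
    edgesWithin (insert v T) M = edgesWithin T M ∨
      ∃ e ∈ newEdges T v, edgesWithin (insert v T) M = insert e (edgesWithin T M) := by
  have hnew : ∀ e, e ∈ edgesWithin (insert v T) M ↔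
      e ∈ edgesWithin T M ∨ (e ∈ M ∧ e ∈ newEdges T v) := by
    intro e
    simp only [newEdges, edgesWithin, Finset.mem_sdiff, Finset.mem_filter, Finset.mem_univ,
      true_and, Finset.mem_insert]
    tauto
  by_cases h : ∃ e ∈ M, e ∈ newEdges T v
  · obtain ⟨e, he, hev⟩ := h
    refine Or.inr ⟨e, hev, Finset.ext fun e' => ?_⟩
    rw [hnew, Finset.mem_insert, or_comm]
    refine or_congr_left ⟨fun h' => hM.eq_of_mem_newEdges h'.1 he h'.2 hev, ?_⟩
    rintro rfl
    exact ⟨he, hev⟩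
  · refine Or.inl (Finset.ext fun e => ?_)
    rw [hnew]
    exact or_iff_left fun h' => h ⟨e, h'⟩

/-- A bound on all weighted link sizes gives a bound on the number of members of a link that cover
further vertices. -/
lemma card_vertexLink_covering_le {𝓜 : Finset (Finset (Fin n × Fin n))} {ℓ : ℕ} (hℓ : 1 ≤ ℓ)
    (h𝓜 : ∀ M ∈ 𝓜, IsMatching M ∧ #M = ℓ) {κ B : ℝ} (hκ : 0 < κ) (hB0 : 0 ≤ B)
    (hB : ∀ T N, (#(vertexLink 𝓜 T N) : ℝ) * κ ^ #T * (ℓ : ℝ) ^ #N ≤ B)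
    (D T : Finset (Fin n ⊕ Fin n)) (N : Finset (Fin n × Fin n)) (hD : Disjoint D T) :
    (#{M ∈ vertexLink 𝓜 T N | D ⊆ coveredVertices M} : ℝ) *
      (κ / 2) ^ #D * κ ^ #T * (ℓ : ℝ) ^ #N ≤ B := by
  have hℓ0 : (0 : ℝ) < ℓ := by exact_mod_cast hℓ
  induction D using Finset.induction_on generalizing T N with
  | empty => simpa using hB T N
  | insert v D hv ih =>
    rw [Finset.disjoint_insert_left] at hD
    have hDv : Disjoint D (insert v T) := Finset.disjoint_insert_right.2 ⟨hv, hD.2⟩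
    rcases Finset.eq_empty_or_nonempty
      {M ∈ vertexLink 𝓜 T N | insert v D ⊆ coveredVertices M} with h0 | ⟨M₀, hM₀⟩
    · rw [h0]; simpa using hB0
    simp only [vertexLink, Finset.mem_filter] at hM₀
    obtain ⟨⟨hM₀, hTM₀, hNM₀⟩, -⟩ := hM₀
    have hE : #(newEdges T v) ≤ ℓ := (h𝓜 M₀ hM₀).2 ▸ card_newEdges_le hTM₀ v
    have hnotMem : ∀ e ∈ newEdges T v, e ∉ N := by
      intro e he heN
      rw [← hNM₀] at heN
      simp only [newEdges, edgesWithin, Finset.mem_sdiff, Finset.mem_filter, Finset.mem_univ,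
        true_and] at he heN
      exact he.2 heN.2
    have hcover : {M ∈ vertexLink 𝓜 T N | insert v D ⊆ coveredVertices M} ⊆
        {M ∈ vertexLink 𝓜 (insert v T) N | D ⊆ coveredVertices M} ∪
          (newEdges T v).biUnion fun e =>
            {M ∈ vertexLink 𝓜 (insert v T) (insert e N) | D ⊆ coveredVertices M} := by
      intro M hM
      simp only [vertexLink, Finset.mem_filter, Finset.mem_union, Finset.mem_biUnion,
        Finset.insert_subset_iff] at hM ⊢
      obtain ⟨⟨hM, hTM, hNM⟩, hvM, hDM⟩ := hM
      rcases (h𝓜 M hM).1.edgesWithin_insert T v with h | ⟨e, he, h⟩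
      · exact Or.inl ⟨⟨hM, ⟨hvM, hTM⟩, h.trans hNM⟩, hDM⟩
      · exact Or.inr ⟨e, he, ⟨hM, ⟨hvM, hTM⟩, by rw [h, hNM]⟩, hDM⟩
    have hcard : (#{M ∈ vertexLink 𝓜 T N | insert v D ⊆ coveredVertices M} : ℝ) ≤
        #{M ∈ vertexLink 𝓜 (insert v T) N | D ⊆ coveredVertices M} +
          ∑ e ∈ newEdges T v,
            (#{M ∈ vertexLink 𝓜 (insert v T) (insert e N) | D ⊆ coveredVertices M} : ℝ) := by
      have h₁ := (Finset.card_le_card hcover).trans (Finset.card_union_le _ _)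
      exact_mod_cast h₁.trans (Nat.add_le_add_left Finset.card_biUnion_le _)
    set w : ℝ := (κ / 2) ^ #D * κ ^ (#T + 1) * (ℓ : ℝ) ^ #N with hw
    have hw0 : 0 < w := by positivity
    have hfirst := ih (insert v T) N hDv
    rw [Finset.card_insert_of_notMem hD.1, mul_assoc, mul_assoc, ← mul_assoc ((κ / 2) ^ #D),
      ← hw] at hfirst
    have hrest : ∀ e ∈ newEdges T v,
        (#{M ∈ vertexLink 𝓜 (insert v T) (insert e N) | D ⊆ coveredVertices M} : ℝ) * w ≤
          B / ℓ := by
      intro e he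
      have h := ih (insert v T) (insert e N) hDv
      rw [Finset.card_insert_of_notMem hD.1, Finset.card_insert_of_notMem (hnotMem e he)] at h
      rw [le_div_iff₀ hℓ0]
      calc _ = _ := by rw [hw]; ring
        _ ≤ B := h
    have hsum : (∑ e ∈ newEdges T v,
        (#{M ∈ vertexLink 𝓜 (insert v T) (insert e N) | D ⊆ coveredVertices M} : ℝ)) * w ≤ B := by
      rw [Finset.sum_mul]
      refine (Finset.sum_le_card_nsmul _ _ _ hrest).trans ?_
      rw [nsmul_eq_mul]
      calc (#(newEdges T v) : ℝ) * (B / ℓ) ≤ ℓ * (B / ℓ) := by gcongr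
        _ = B := by field_simp
    have htotal := (mul_le_mul_of_nonneg_right hcard hw0.le).trans_eq (add_mul _ _ _)
    rw [Finset.card_insert_of_notMem hv]
    calc _ = (#{M ∈ vertexLink 𝓜 T N | insert v D ⊆ coveredVertices M} : ℝ) * w / 2 := by
          rw [hw]; ring
      _ ≤ B := by linarith

/-- A large family of `ℓ`-matchings has a link with at least two members that is spread over
vertices. -/
lemma exists_spread_vertexLink {𝓜 : Finset (Finset (Fin n × Fin n))} {ℓ : ℕ} (hℓ : 1 ≤ ℓ)
    (h𝓜 : ∀ M ∈ 𝓜, IsMatching M ∧ #M = ℓ) {κ : ℝ} (hκ : 1 ≤ κ)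
    (hcard : (κ ^ 2 * ℓ) ^ ℓ < #𝓜) :
    ∃ T N, 2 ≤ #(vertexLink 𝓜 T N) ∧ ∀ D, Disjoint D T →
      (#{M ∈ vertexLink 𝓜 T N | D ⊆ coveredVertices M} : ℝ) * (κ / 2) ^ #D ≤
        #(vertexLink 𝓜 T N) := by
  have hℓ1 : (1 : ℝ) ≤ ℓ := by exact_mod_cast hℓ
  have hκ0 : 0 < κ := by linarith
  let Φ : Finset (Fin n ⊕ Fin n) × Finset (Fin n × Fin n) → ℝ := fun x =>
    (#(vertexLink 𝓜 x.1 x.2) : ℝ) * κ ^ #x.1 * (ℓ : ℝ) ^ #x.2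
  obtain ⟨⟨T, N⟩, -, hmax⟩ := Finset.exists_max_image univ Φ ⟨(∅, ∅), Finset.mem_univ _⟩
  have hΦ : (κ ^ 2 * ℓ) ^ ℓ < Φ (T, N) := by
    refine hcard.trans_le (le_trans (le_of_eq ?_) (hmax (∅, ∅) (Finset.mem_univ _)))
    have : vertexLink 𝓜 ∅ ∅ = 𝓜 := by
      simp [vertexLink, edgesWithin]
    simp [Φ, this]
  have hpos : 0 < Φ (T, N) := lt_trans (by positivity) hΦ
  refine ⟨T, N, ?_, fun D hD => ?_⟩
  · by_contra hlt
    have hle : #(vertexLink 𝓜 T N) ≤ 1 := by omega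
    rcases Finset.eq_empty_or_nonempty (vertexLink 𝓜 T N) with h0 | ⟨M, hM⟩
    · simp [Φ, h0] at hpos
    simp only [vertexLink, Finset.mem_filter] at hM
    obtain ⟨hM, hTM, hNM⟩ := hM
    have hT : #T ≤ 2 * ℓ := (h𝓜 M hM).2 ▸
      (Finset.card_le_card hTM).trans (card_coveredVertices_le M)
    have hN : #N ≤ ℓ := (h𝓜 M hM).2 ▸ hNM ▸ Finset.card_filter_le _ _
    refine absurd hΦ (not_lt.2 ?_)
    calc Φ (T, N) ≤ 1 * κ ^ (2 * ℓ) * (ℓ : ℝ) ^ ℓ := by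
          dsimp only [Φ]
          gcongr
          · exact_mod_cast hle
      _ = (κ ^ 2 * ℓ) ^ ℓ := by rw [one_mul, mul_pow, pow_mul]
  · have h := card_vertexLink_covering_le hℓ h𝓜 hκ0 hpos.le
      (fun T' N' => hmax (T', N') (Finset.mem_univ _)) D T N hD
    dsimp only [Φ] at h
    rw [mul_assoc, mul_assoc (#(vertexLink 𝓜 T N) : ℝ)] at h
    exact le_of_mul_le_mul_right h (by positivity)

/-- The colour constraints outside `T` that make an edge monochromatic when `T` is coloured
by `c`. -/
def edgeLiterals (T : Finset (Fin n ⊕ Fin n)) (c : Fin n ⊕ Fin n → Bool)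
    (e : Fin n × Fin n) : Finset ((Fin n ⊕ Fin n) × Bool) :=
  if Sum.inl e.1 ∈ T then
    if Sum.inr e.2 ∈ T then ∅ else {(Sum.inr e.2, c (Sum.inl e.1))}
  else if Sum.inr e.2 ∈ T then {(Sum.inl e.1, c (Sum.inr e.2))}
  else {(Sum.inl e.1, true), (Sum.inr e.2, true)}

lemma card_edgeLiterals_le (T : Finset (Fin n ⊕ Fin n)) (c : Fin n ⊕ Fin n → Bool)
    (e : Fin n × Fin n) : #(edgeLiterals T c e) ≤ 2 := by
  unfold edgeLiterals
  split_ifs <;> simp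

lemma endpoint_of_mem_edgeLiterals {T : Finset (Fin n ⊕ Fin n)} {c : Fin n ⊕ Fin n → Bool}
    {e : Fin n × Fin n} {x : (Fin n ⊕ Fin n) × Bool} (hx : x ∈ edgeLiterals T c e) :
    x.1 ∉ T ∧ (x.1 = Sum.inl e.1 ∨ x.1 = Sum.inr e.2) := by
  unfold edgeLiterals at hx
  split_ifs at hx with h₁ h₂ h₂
  · simp at hx
  · rw [Finset.mem_singleton] at hx; subst hx; exact ⟨h₂, Or.inr rfl⟩
  · rw [Finset.mem_singleton] at hx; subst hx; exact ⟨h₁, Or.inl rfl⟩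
  · rw [Finset.mem_insert, Finset.mem_singleton] at hx
    rcases hx with rfl | rfl
    · exact ⟨h₁, Or.inl rfl⟩
    · exact ⟨h₂, Or.inr rfl⟩

lemma edgeLiterals_consistent {T : Finset (Fin n ⊕ Fin n)} {c : Fin n ⊕ Fin n → Bool}
    {e : Fin n × Fin n} {v : Fin n ⊕ Fin n} (hf : (v, false) ∈ edgeLiterals T c e) :
    (v, true) ∉ edgeLiterals T c e := by
  unfold edgeLiterals at hf ⊢
  split_ifs at hf ⊢ <;> simp_all

/-- The colour constraints outside `T` that make all edges of `M` not within `T` monochromatic. -/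
def matchingLiterals (T : Finset (Fin n ⊕ Fin n)) (c : Fin n ⊕ Fin n → Bool)
    (M : Finset (Fin n × Fin n)) : Finset ((Fin n ⊕ Fin n) × Bool) :=
  M.biUnion (edgeLiterals T c)

lemma card_matchingLiterals_le (T : Finset (Fin n ⊕ Fin n)) (c : Fin n ⊕ Fin n → Bool)
    (M : Finset (Fin n × Fin n)) : #(matchingLiterals T c M) ≤ 2 * #M :=
  (Finset.card_biUnion_le_card_mul _ _ 2 fun e _ => card_edgeLiterals_le T c e).trans_eq
    (mul_comm _ _)

lemma covered_of_mem_matchingLiterals {T : Finset (Fin n ⊕ Fin n)}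
    {c : Fin n ⊕ Fin n → Bool} {M : Finset (Fin n × Fin n)} {x : (Fin n ⊕ Fin n) × Bool}
    (hx : x ∈ matchingLiterals T c M) : x.1 ∉ T ∧ x.1 ∈ coveredVertices M := by
  obtain ⟨e, he, hxe⟩ := Finset.mem_biUnion.1 hx
  obtain ⟨hT, h | h⟩ := endpoint_of_mem_edgeLiterals hxe
  · exact ⟨hT, h ▸ inl_mem_coveredVertices.2 ⟨e, he, rfl⟩⟩
  · exact ⟨hT, h ▸ inr_mem_coveredVertices.2 ⟨e, he, rfl⟩⟩

lemma IsMatching.matchingLiterals_consistent {M : Finset (Fin n × Fin n)} (hM : IsMatching M)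
    {T : Finset (Fin n ⊕ Fin n)} {c : Fin n ⊕ Fin n → Bool} {v : Fin n ⊕ Fin n}
    (hf : (v, false) ∈ matchingLiterals T c M) : (v, true) ∉ matchingLiterals T c M := by
  intro ht
  obtain ⟨e, he, hve⟩ := Finset.mem_biUnion.1 hf
  obtain ⟨e', he', hve'⟩ := Finset.mem_biUnion.1 ht
  have hee' : e = e' := by
    by_contra hne
    obtain ⟨h₁, h₂⟩ := hM e he e' he' hne
    rcases (endpoint_of_mem_edgeLiterals hve).2 with h | h <;>
      rcases (endpoint_of_mem_edgeLiterals hve').2 with h' | h' <;>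
      simp_all
  exact edgeLiterals_consistent hve (hee' ▸ hve')

lemma monochromatic_of_edgeLiterals_subset {T : Finset (Fin n ⊕ Fin n)}
    {c : Fin n ⊕ Fin n → Bool} {e : Fin n × Fin n} {R : Finset (Fin n ⊕ Fin n)}
    (he : ¬ (Sum.inl e.1 ∈ T ∧ Sum.inr e.2 ∈ T)) (hsub : edgeLiterals T c e ⊆ literals univ R) :
    T.piecewise c (fun v => decide (v ∈ R)) (Sum.inl e.1) =
      T.piecewise c (fun v => decide (v ∈ R)) (Sum.inr e.2) := by
  have hlit : ∀ v b, (v, b) ∈ literals univ R ↔ decide (v ∈ R) = b := by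
    intro v b; simp [literals]
  unfold edgeLiterals at hsub
  split_ifs at hsub with h₁ h₂ h₂
  · exact absurd ⟨h₁, h₂⟩ he
  · rw [Finset.singleton_subset_iff, hlit] at hsub
    simp [Finset.piecewise, h₁, h₂, hsub]
  · rw [Finset.singleton_subset_iff, hlit] at hsub
    simp [Finset.piecewise, h₁, h₂, hsub]
  · rw [Finset.insert_subset_iff, Finset.singleton_subset_iff, hlit, hlit] at hsub
    simp only [Finset.piecewise, h₁, h₂, if_false]
    rw [hsub.1, hsub.2]

/-- Spreadness over vertices passes to the families of colour constraints. -/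
lemma card_matchingLiterals_superset_le {F : Finset (Finset (Fin n × Fin n))}
    (hF : ∀ M ∈ F, IsMatching M) {T : Finset (Fin n ⊕ Fin n)} {κ : ℝ}
    (hspread : ∀ D, Disjoint D T →
      (#{M ∈ F | D ⊆ coveredVertices M} : ℝ) * κ ^ #D ≤ #F)
    (hκ : 0 ≤ κ) (c : Fin n ⊕ Fin n → Bool) (Q : Finset ((Fin n ⊕ Fin n) × Bool)) :
    (#{M ∈ F | Q ⊆ matchingLiterals T c M} : ℝ) * κ ^ #Q ≤ #F := by
  rcases Finset.eq_empty_or_nonempty {M ∈ F | Q ⊆ matchingLiterals T c M} with h0 | ⟨M₀, hM₀⟩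
  · rw [h0]; simp
  rw [Finset.mem_filter] at hM₀
  have hinj : Set.InjOn Prod.fst (Q : Set ((Fin n ⊕ Fin n) × Bool)) := by
    rintro ⟨v, b⟩ hx ⟨w, b'⟩ hy rfl
    have h₁ := hM₀.2 hx
    have h₂ := hM₀.2 hy
    have := (hF M₀ hM₀.1).matchingLiterals_consistent (T := T) (c := c) (v := v)
    cases b <;> cases b' <;> simp_all
  have hdisj : Disjoint (Q.image Prod.fst) T := by
    rw [Finset.disjoint_left]
    intro v hv
    obtain ⟨x, hx, rfl⟩ := Finset.mem_image.1 hv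
    exact (covered_of_mem_matchingLiterals (hM₀.2 hx)).1
  have h := hspread _ hdisj
  rw [Finset.card_image_of_injOn hinj] at h
  refine le_trans (mul_le_mul_of_nonneg_right ?_ (by positivity)) h
  refine Nat.cast_le.2 (Finset.card_le_card fun M hM => ?_)
  rw [Finset.mem_filter] at hM ⊢
  refine ⟨hM.1, fun v hv => ?_⟩
  obtain ⟨x, hx, rfl⟩ := Finset.mem_image.1 hv
  exact (covered_of_mem_matchingLiterals (hM.2 hx)).2

end Matching

section Colouring

/-- To bound a sum over all functions it suffices to bound the sums with the values on `T` fixed. -/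
lemma sum_le_of_sum_piecewise_le {V : Type*} [Fintype V] [DecidableEq V] (T : Finset V)
    (g : (V → Bool) → ℝ) {C : ℝ} (h : ∀ a, ∑ b, g (T.piecewise a b) ≤ C) :
    ∑ a, g a ≤ C := by
  have hinv : Function.Involutive fun x : (V → Bool) × (V → Bool) =>
      (T.piecewise x.1 x.2, T.piecewise x.2 x.1) := by
    intro x
    refine Prod.ext (funext fun v => ?_) (funext fun v => ?_) <;>
      by_cases hv : v ∈ T <;> simp [hv]
  have hsum : ∑ a, ∑ b, g (T.piecewise a b) = (Fintype.card (V → Bool) : ℝ) * ∑ a, g a := by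
    have := Equiv.sum_comp hinv.toPerm fun x : (V → Bool) × (V → Bool) => g x.1
    simp only [Function.Involutive.coe_toPerm, Fintype.sum_prod_type] at this
    rw [this, Finset.mul_sum]
    exact Finset.sum_congr rfl fun a _ => by simp
  have hle : (Fintype.card (V → Bool) : ℝ) * ∑ a, g a ≤ Fintype.card (V → Bool) * C := by
    rw [← hsum]
    refine (Finset.sum_le_card_nsmul univ _ C fun a _ => h a).trans_eq ?_
    rw [nsmul_eq_mul, Finset.card_univ]
  exact le_of_mul_le_mul_left hle (by exact_mod_cast Fintype.card_pos)

lemma sum_bool_fun_eq_sum_finset {V : Type*} [Fintype V] [DecidableEq V]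
    (g : (V → Bool) → ℝ) : ∑ b, g b = ∑ R : Finset V, g fun v => decide (v ∈ R) := by
  refine (Function.Bijective.sum_comp (e := fun (R : Finset V) v => decide (v ∈ R))
    ⟨fun R R' h => ?_, fun b => ⟨({v | b v = true} : Finset V), ?_⟩⟩ g).symm
  · ext v
    simpa using congrFun h v
  · ext v
    simp

variable {n : ℕ}

lemma oddColouring_iff (c : Fin n ⊕ Fin n → Bool) :
    OddColouring c ↔ Odd #{v | c v = true} := by
  rw [OddColouring, Nat.card_eq_fintype_card, Fintype.card_subtype]

lemma oddColouring_update_true {c : Fin n ⊕ Fin n → Bool} {v : Fin n ⊕ Fin n}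
    (hv : c v = false) : OddColouring (Function.update c v true) ↔ ¬ OddColouring c := by
  rw [oddColouring_iff, oddColouring_iff]
  have h : Finset.univ.filter (fun w => Function.update c v true w = true) =
      insert v (Finset.univ.filter fun w => c w = true) := by
    ext w
    by_cases hw : w = v <;> simp [hw]
  rw [h, Finset.card_insert_of_notMem (by simp [hv]), Nat.odd_add_one]

lemma oddColouring_flip (c : Fin n ⊕ Fin n → Bool) (v : Fin n ⊕ Fin n) :
    OddColouring (Function.update c v (!c v)) ↔ ¬ OddColouring c := by
  rcases hv : c v with _ | _
  · exact oddColouring_update_true hv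
  · have h := oddColouring_update_true (c := Function.update c v false) (v := v) (by simp)
    rw [Function.update_idem, ← hv, Function.update_eq_self] at h
    rw [h, not_not]
    simp

open Classical in
/-- For `n ≥ 1`, half of the colourings are odd. -/
lemma two_mul_card_oddColouring (hn : 1 ≤ n) :
    2 * #{c : Fin n ⊕ Fin n → Bool | OddColouring c} = 2 ^ (2 * n) := by
  let v : Fin n ⊕ Fin n := Sum.inl ⟨0, hn⟩
  have hcard : #{c : Fin n ⊕ Fin n → Bool | OddColouring c} =
      #{c : Fin n ⊕ Fin n → Bool | ¬ OddColouring c} := by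
    refine Finset.card_nbij' (fun c => Function.update c v (!c v))
      (fun c => Function.update c v (!c v)) ?_ ?_ ?_ ?_
    · intro c hc; simpa [oddColouring_flip] using hc
    · intro c hc; simpa [oddColouring_flip] using hc
    · intro c _; simp
    · intro c _; simp
  have hsum := Finset.card_filter_add_card_filter_not (s := (univ : Finset (Fin n ⊕ Fin n → Bool)))
    OddColouring
  rw [← hcard, Finset.card_univ] at hsum
  rw [two_mul, hsum]
  simp [two_mul]

open Classical in
/-- A family is a matching sunflower as soon as few colourings fail for it. -/
lemma isMatchingSunflower_of_card_le (hn : 1 ≤ n) {ε : ℝ}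
    {F : Finset (Finset (Fin n × Fin n))} (hF : 2 ≤ #F)
    (hfail : (#{c : Fin n ⊕ Fin n → Bool | ¬ ∃ M ∈ F, ∀ e ∈ M \ F.inf id,
      c (Sum.inl e.1) = c (Sum.inr e.2)} : ℝ) ≤ ε / 2 * 2 ^ (2 * n)) :
    IsMatchingSunflower n ε F := by
  refine ⟨hF, ?_⟩
  have hodd : (2 : ℝ) * #{c : Fin n ⊕ Fin n → Bool | OddColouring c} = 2 ^ (2 * n) := by
    exact_mod_cast two_mul_card_oddColouring hn
  rw [Nat.card_eq_fintype_card, Nat.card_eq_fintype_card, Fintype.card_subtype,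
    Fintype.card_subtype]
  have hpos : (0 : ℝ) < #{c : Fin n ⊕ Fin n → Bool | OddColouring c} := by
    have : (0 : ℝ) < 2 ^ (2 * n) := by positivity
    linarith
  rw [le_div_iff₀ hpos]
  have hsplit : (#{c : Fin n ⊕ Fin n → Bool | OddColouring c} : ℝ) ≤
      #{c : Fin n ⊕ Fin n → Bool | OddColouring c ∧ ∃ M ∈ F, ∀ e ∈ M \ F.inf id,
        c (Sum.inl e.1) = c (Sum.inr e.2)} +
      #{c : Fin n ⊕ Fin n → Bool | ¬ ∃ M ∈ F, ∀ e ∈ M \ F.inf id,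
        c (Sum.inl e.1) = c (Sum.inr e.2)} := by
    refine mod_cast (Finset.card_le_card fun c hc => ?_).trans (Finset.card_union_le _ _)
    simp only [Finset.mem_union, Finset.mem_filter, Finset.mem_univ, true_and] at hc ⊢
    exact (Classical.em _).imp (fun h => ⟨hc, h⟩) id
  rw [← hodd] at hfail
  linarith

open Classical in
/-- Few colourings fail for a link that is spread over vertices. -/
lemma card_failing_colourings_le {𝓜 : Finset (Finset (Fin n × Fin n))} {ℓ j m : ℕ}
    (h𝓜 : ∀ M ∈ 𝓜, IsMatching M ∧ #M = ℓ) (hm : 1 ≤ m) (hj : 2 * ℓ < 2 ^ j)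
    {T : Finset (Fin n ⊕ Fin n)} {N : Finset (Fin n × Fin n)}
    (hne : (vertexLink 𝓜 T N).Nonempty)
    (hspread : ∀ D, Disjoint D T →
      (#{M ∈ vertexLink 𝓜 T N | D ⊆ coveredVertices M} : ℝ) * (64 * m) ^ #D ≤
        #(vertexLink 𝓜 T N)) :
    (#{c : Fin n ⊕ Fin n → Bool | ¬ ∃ M ∈ vertexLink 𝓜 T N,
      ∀ e ∈ M \ (vertexLink 𝓜 T N).inf id, c (Sum.inl e.1) = c (Sum.inr e.2)} : ℝ) ≤
      4 ^ j / 2 ^ m * 2 ^ (2 * n) := by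
  set F := vertexLink 𝓜 T N with hFdef
  have hF : ∀ M ∈ F, M ∈ 𝓜 ∧ edgesWithin T M = N := fun M hM => by
    simp only [hFdef, vertexLink, Finset.mem_filter] at hM
    exact ⟨hM.1, hM.2.2⟩
  have hcore : N ⊆ F.inf id := Finset.le_inf fun M hM => by
    rw [← (hF M hM).2]; exact Finset.filter_subset _ _
  rw [← Finset.sum_boole]
  refine sum_le_of_sum_piecewise_le T _ fun a => ?_
  have havg := assignAvg_missIndicator_le hne (A := matchingLiterals T a) (j := j) hm
    (fun M hM v => (h𝓜 M (hF M hM).1).1.matchingLiterals_consistent)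
    (fun M hM => ((card_matchingLiterals_le T a M).trans_eq
      (by rw [(h𝓜 M (hF M hM).1).2])).trans_lt hj)
    (fun Q _ => card_matchingLiterals_superset_le (fun M hM => (h𝓜 M (hF M hM).1).1) hspread
      (by positivity) a Q)
  rw [assignAvg, div_le_iff₀ (by positivity)] at havg
  rw [sum_bool_fun_eq_sum_finset]
  calc _ ≤ ∑ R ∈ (univ : Finset (Fin n ⊕ Fin n)).powerset,
        missIndicator F (matchingLiterals T a) (∅ ∪ literals univ R) := by
        rw [Finset.powerset_univ]
        refine Finset.sum_le_sum fun R _ => ?_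
        by_cases hR : ∃ M ∈ F, matchingLiterals T a M ⊆ literals univ R
        · obtain ⟨M, hM, hMR⟩ := hR
          refine (if_neg (not_not.2 ⟨M, hM, fun e he => ?_⟩)).trans_le
            (missIndicator_nonneg _ _ _)
          rw [Finset.mem_sdiff] at he
          refine monochromatic_of_edgeLiterals_subset (fun hT => he.2 (hcore ?_))
            ((Finset.subset_biUnion_of_mem _ he.1).trans hMR)
          rw [← (hF M hM).2]
          exact Finset.mem_filter.2 ⟨he.1, hT⟩
        · rw [Finset.empty_union, missIndicator, if_neg hR]
          split_ifs <;> norm_num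
    _ ≤ _ := by simpa [two_mul] using havg

end Colouring

lemma exists_rounds {ℓ : ℕ} (hℓ : 1 ≤ ℓ) {ε : ℝ} (hε : 0 < ε) (hε2 : ε < 1 / 2) :
    ∃ m : ℕ, 1 ≤ m ∧ (m : ℝ) ≤ 13 * Real.log (ℓ / ε) ∧ 0 < Real.log (ℓ / ε) ∧
      32 * (ℓ : ℝ) ^ 2 / ε ≤ 2 ^ m := by
  have hℓ1 : (1 : ℝ) ≤ ℓ := by exact_mod_cast hℓ
  set x : ℝ := ℓ / ε with hx
  have hx2 : 2 ≤ x := by rw [hx, le_div_iff₀ hε]; linarith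
  have hlog2 := Real.log_two_gt_d9
  have hL : Real.log 2 ≤ Real.log x := Real.log_le_log (by norm_num) hx2
  have hL0 : 0 < Real.log x := by linarith
  refine ⟨⌈11 * Real.log x⌉₊, Nat.one_le_ceil_iff.2 (by positivity), ?_, hL0, ?_⟩
  · have := Nat.ceil_lt_add_one (a := 11 * Real.log x) (by positivity)
    linarith
  · calc 32 * (ℓ : ℝ) ^ 2 / ε ≤ 32 * x ^ 2 := by
          rw [hx, div_pow, ← mul_div_assoc]
          refine div_le_div_of_nonneg_left (by positivity) (by positivity) ?_
          nlinarith
      _ ≤ x ^ 5 * x ^ 2 := by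
          gcongr
          calc (32 : ℝ) = 2 ^ 5 := by norm_num
            _ ≤ x ^ 5 := by gcongr
      _ = Real.exp (7 * Real.log x) := by
          rw [← pow_add, show (7 : ℝ) = ((7 : ℕ) : ℝ) by norm_num, Real.exp_nat_mul,
            Real.exp_log (by linarith)]
      _ ≤ Real.exp (⌈11 * Real.log x⌉₊ * Real.log 2) := by
          refine Real.exp_le_exp.2 ?_
          have := Nat.le_ceil (11 * Real.log x)
          nlinarith
      _ = 2 ^ ⌈11 * Real.log x⌉₊ := by
          rw [Real.exp_nat_mul, Real.exp_log (by norm_num)]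

/-- Matching Sunflower Lemma: there is a universal constant `c > 0` such that for all
`n, ℓ ≥ 1` and `0 < ε < 1/2`, every family of `ℓ`-matchings in `K_{n,n}` of size at least
`(c · ℓ · log²(ℓ/ε))^ℓ` contains a subfamily of size at least 2 that is an
`ε`-matching sunflower. -/
theorem matching_sunflower_lemma :
    ∃ c : ℝ, 0 < c ∧ ∀ n ℓ : ℕ, 1 ≤ n → 1 ≤ ℓ → ∀ ε : ℝ, 0 < ε → ε < 1 / 2 →
      ∀ 𝓜 : Finset (Finset (Fin n × Fin n)),
        (∀ M ∈ 𝓜, IsMatching M ∧ M.card = ℓ) →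
        (c * (ℓ : ℝ) * (Real.log ((ℓ : ℝ) / ε)) ^ 2) ^ ℓ ≤ (𝓜.card : ℝ) →
        ∃ 𝓜' ⊆ 𝓜, IsMatchingSunflower n ε 𝓜' := by
  refine ⟨1665 ^ 2, by norm_num, fun n ℓ hn hℓ ε hε hε2 𝓜 h𝓜 hcard => ?_⟩
  obtain ⟨m, hm, hmL, hL, hpow⟩ := exists_rounds hℓ hε hε2
  have hℓ0 : (0 : ℝ) < ℓ := by exact_mod_cast hℓ
  have hm1 : (1 : ℝ) ≤ m := by exact_mod_cast hm
  obtain ⟨T, N, hF, hspread⟩ := exists_spread_vertexLink hℓ h𝓜 (κ := 128 * m) (by linarith) (by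
    refine lt_of_lt_of_le (pow_lt_pow_left₀ ?_ (by positivity) (by omega)) hcard
    have hlt : 128 * (m : ℝ) < 1665 * Real.log (ℓ / ε) := by linarith
    calc (128 * (m : ℝ)) ^ 2 * ℓ < (1665 * Real.log (ℓ / ε)) ^ 2 * ℓ := by gcongr
      _ = _ := by ring)
  refine ⟨vertexLink 𝓜 T N, Finset.filter_subset _ _, isMatchingSunflower_of_card_le hn hF ?_⟩
  have hj : 2 * ℓ < 2 ^ (Nat.log 2 (2 * ℓ) + 1) := Nat.lt_pow_succ_log_self (by norm_num) _
  have hj' : 2 ^ Nat.log 2 (2 * ℓ) ≤ 2 * ℓ := Nat.pow_log_le_self 2 (by omega)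
  refine (card_failing_colourings_le h𝓜 hm hj (Finset.card_pos.1 (by omega)) fun D hD => ?_).trans ?_
  · have h := hspread D hD
    rwa [show 128 * (m : ℝ) / 2 = 64 * m by ring] at h
  · refine mul_le_mul_of_nonneg_right ?_ (by positivity)
    have h4 : (4 : ℝ) ^ (Nat.log 2 (2 * ℓ) + 1) ≤ 16 * (ℓ : ℝ) ^ 2 := by
      have hj2 : (2 : ℝ) ^ Nat.log 2 (2 * ℓ) ≤ 2 * ℓ := by exact_mod_cast hj'
      calc (4 : ℝ) ^ (Nat.log 2 (2 * ℓ) + 1) = 4 * (2 ^ Nat.log 2 (2 * ℓ)) ^ 2 := by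
            rw [pow_succ, ← pow_mul, mul_comm _ 2, pow_mul]; norm_num; ring
        _ ≤ 4 * (2 * (ℓ : ℝ)) ^ 2 := by gcongr
        _ = _ := by ring
    rw [div_le_iff₀ hε] at hpow
    rw [div_le_iff₀ (by positivity)]
    linarith
end

section
/- For every finite family M of ℓ-matchings in K_{n,n} with 1 ≤ ℓ ≤ n, there exists a labelling b : L ⊕ R → Fin ℓ such that the number of matchings M ∈ M that are consistent with b is at least |M| · ℓ! / ℓ^(2ℓ). -/
/-- A matching `M` is consistent with a labelling `b : L ⊕ R → Fin ℓ` if every edge of `M` is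
monochromatic under `b` and distinct edges of `M` receive distinct labels. -/
def ConsistentWith {n ℓ : ℕ} (M : Finset (Fin n × Fin n)) (b : Fin n ⊕ Fin n → Fin ℓ) : Prop :=
  (∀ e ∈ M, b (Sum.inl e.1) = b (Sum.inr e.2)) ∧
  (∀ e ∈ M, ∀ e' ∈ M, e ≠ e' → b (Sum.inl e.1) ≠ b (Sum.inl e'.1))

/-- `V(M)`: the set of endpoints (in `L ⊕ R`) of the edges of `M`. -/
def endpoints {n : ℕ} (M : Finset (Fin n × Fin n)) : Finset (Fin n ⊕ Fin n) :=
  M.image (fun e => Sum.inl e.1) ∪ M.image (fun e => Sum.inr e.2)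

theorem Function.extend_right_cancel {α β γ : Type*} {f : α → β} {s s' : α → γ} {g g' : β → γ}
    (hext : Function.extend f s g = Function.extend f s' g') (hcomp : g ∘ f = g' ∘ f) :
    g = g' := by
  funext y
  by_cases hy : ∃ x, f x = y
  · obtain ⟨x, rfl⟩ := hy
    exact congrFun hcomp x
  · simpa [Function.extend_apply' _ _ _ hy] using congrFun hext y

namespace IsMatching

variable {n ℓ : ℕ} {M : Finset (Fin n × Fin n)}

theorem injective_fst (hM : IsMatching M) : Function.Injective fun e : M => e.1.1 := by
  intro e e' h
  by_contra hne
  exact (hM e e.2 e' e'.2 fun h' => hne (Subtype.ext h')).1 h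

theorem injective_snd (hM : IsMatching M) : Function.Injective fun e : M => e.1.2 := by
  intro e e' h
  by_contra hne
  exact (hM e e.2 e' e'.2 fun h' => hne (Subtype.ext h')).2 h

end IsMatching

/-- The labelling `b`, overwritten at both endpoints of each edge `e ∈ M` by `s e`. -/
noncomputable def overwrite {n ℓ : ℕ} (M : Finset (Fin n × Fin n)) (s : M → Fin ℓ)
    (b : Fin n ⊕ Fin n → Fin ℓ) : Fin n ⊕ Fin n → Fin ℓ :=
  Sum.elim (Function.extend (fun e : M => e.1.1) s (b ∘ Sum.inl))
    (Function.extend (fun e : M => e.1.2) s (b ∘ Sum.inr))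

namespace IsMatching

variable {n ℓ : ℕ} {M : Finset (Fin n × Fin n)}

theorem overwrite_inl (hM : IsMatching M) (s : M → Fin ℓ) (b : Fin n ⊕ Fin n → Fin ℓ) (e : M) :
    overwrite M s b (Sum.inl e.1.1) = s e :=
  hM.injective_fst.extend_apply s _ e

theorem overwrite_inr (hM : IsMatching M) (s : M → Fin ℓ) (b : Fin n ⊕ Fin n → Fin ℓ) (e : M) :
    overwrite M s b (Sum.inr e.1.2) = s e :=
  hM.injective_snd.extend_apply s _ e

theorem consistentWith_overwrite (hM : IsMatching M) {s : M → Fin ℓ} (hs : Function.Injective s)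
    (b : Fin n ⊕ Fin n → Fin ℓ) : ConsistentWith M (overwrite M s b) := by
  refine ⟨fun e he => ?_, fun e he e' he' hne heq => hne ?_⟩
  · rw [hM.overwrite_inl s b ⟨e, he⟩, hM.overwrite_inr s b ⟨e, he⟩]
  · rw [hM.overwrite_inl s b ⟨e, he⟩, hM.overwrite_inl s b ⟨e', he'⟩] at heq
    exact congrArg Subtype.val (hs heq)

open Classical in
/-- At least an `ℓ! / ℓ ^ (2ℓ)` fraction of all labellings is consistent with a given
`ℓ`-matching. -/
theorem factorial_mul_card_le (hM : IsMatching M) (hcard : M.card = ℓ) :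
    ℓ.factorial * Fintype.card (Fin n ⊕ Fin n → Fin ℓ) ≤
      Fintype.card {b : Fin n ⊕ Fin n → Fin ℓ // ConsistentWith M b} * ℓ ^ (2 * ℓ) := by
  let Φ : (M ≃ Fin ℓ) × (Fin n ⊕ Fin n → Fin ℓ) →
      {b : Fin n ⊕ Fin n → Fin ℓ // ConsistentWith M b} × (M → Fin ℓ) × (M → Fin ℓ) :=
    fun p => (⟨overwrite M p.1 p.2, hM.consistentWith_overwrite p.1.injective p.2⟩,
      fun e => p.2 (Sum.inl e.1.1), fun e => p.2 (Sum.inr e.1.2))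
  have hΦ : Function.Injective Φ := by
    rintro ⟨s, b⟩ ⟨s', b'⟩ h
    simp only [Φ, Prod.mk.injEq, Subtype.mk.injEq] at h
    obtain ⟨hover, hleft, hright⟩ := h
    have hs : s = s' := by
      ext1 e
      rw [← hM.overwrite_inl s b e, hover, hM.overwrite_inl]
    have hinl : b ∘ Sum.inl = b' ∘ Sum.inl :=
      Function.extend_right_cancel (congrArg (· ∘ Sum.inl) hover) hleft
    have hinr : b ∘ Sum.inr = b' ∘ Sum.inr :=
      Function.extend_right_cancel (congrArg (· ∘ Sum.inr) hover) hright
    have hb : b = b' := by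
      funext v
      cases v with
      | inl u => exact congrFun hinl u
      | inr w => exact congrFun hinr w
    rw [hs, hb]
  have hequiv : Fintype.card (M ≃ Fin ℓ) = ℓ.factorial := by
    rw [Fintype.card_equiv (M.equivFinOfCardEq hcard), Fintype.card_coe, hcard]
  have hfun : Fintype.card (M → Fin ℓ) = ℓ ^ ℓ := by
    rw [Fintype.card_fun, Fintype.card_fin, Fintype.card_coe, hcard]
  have h := Fintype.card_le_of_injective Φ hΦ
  rwa [Fintype.card_prod, Fintype.card_prod, Fintype.card_prod, hequiv, hfun, ← pow_add,
    ← two_mul] at h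

end IsMatching

/-- For every finite family `𝓜` of `ℓ`-matchings in `K_{n,n}` with `1 ≤ ℓ ≤ n`, there is a
labelling `b : L ⊕ R → Fin ℓ` such that the number of matchings in `𝓜` consistent with `b`
is at least `|𝓜| · ℓ! / ℓ^(2ℓ)`. -/
theorem exists_good_labelling (n ℓ : ℕ) (hℓ : 1 ≤ ℓ) (hn : ℓ ≤ n)
    (𝓜 : Finset (Finset (Fin n × Fin n)))
    (h𝓜 : ∀ M ∈ 𝓜, IsMatching M ∧ M.card = ℓ) :
    ∃ b : Fin n ⊕ Fin n → Fin ℓ,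
      (𝓜.card : ℝ) * (Nat.factorial ℓ : ℝ) / (ℓ : ℝ) ^ (2 * ℓ) ≤
        (Nat.card {M : Finset (Fin n × Fin n) // M ∈ 𝓜 ∧ ConsistentWith M b} : ℝ) := by
  classical
  have : NeZero ℓ := ⟨by omega⟩
  have hpow : (0 : ℝ) < (ℓ : ℝ) ^ (2 * ℓ) := by positivity
  have hcount (b : Fin n ⊕ Fin n → Fin ℓ) :
      Nat.card {M : Finset (Fin n × Fin n) // M ∈ 𝓜 ∧ ConsistentWith M b} =
        (𝓜.filter fun M => ConsistentWith M b).card :=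
    Nat.subtype_card _ fun M => by simp
  have hdouble : ∑ b : Fin n ⊕ Fin n → Fin ℓ, (𝓜.filter fun M => ConsistentWith M b).card =
      ∑ M ∈ 𝓜, Fintype.card {b : Fin n ⊕ Fin n → Fin ℓ // ConsistentWith M b} := by
    simp_rw [Fintype.card_subtype]
    exact (Finset.sum_card_bipartiteAbove_eq_sum_card_bipartiteBelow ConsistentWith).symm
  have hlower : 𝓜.card * (ℓ.factorial * Fintype.card (Fin n ⊕ Fin n → Fin ℓ)) ≤
      (∑ b : Fin n ⊕ Fin n → Fin ℓ, (𝓜.filter fun M => ConsistentWith M b).card) *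
        ℓ ^ (2 * ℓ) := by
    rw [hdouble, Finset.sum_mul, ← smul_eq_mul]
    exact Finset.card_nsmul_le_sum _ _ _ fun M hM =>
      (h𝓜 M hM).1.factorial_mul_card_le (h𝓜 M hM).2
  obtain ⟨b, -, hb⟩ := Finset.exists_le_of_sum_le (s := Finset.univ)
    (f := fun _ : Fin n ⊕ Fin n → Fin ℓ =>
      (𝓜.card : ℝ) * (Nat.factorial ℓ : ℝ) / (ℓ : ℝ) ^ (2 * ℓ))
    (g := fun b => ((𝓜.filter fun M => ConsistentWith M b).card : ℝ))
    Finset.univ_nonempty (by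
      rw [Finset.sum_const, nsmul_eq_mul, Finset.card_univ, mul_div_assoc', div_le_iff₀ hpow,
        mul_comm, mul_assoc]
      exact_mod_cast hlower)
  exact ⟨b, by rwa [hcount]⟩
end

section
/- Let b : L ⊕ R → Fin ℓ be a labelling and let M' be a family of ℓ-matchings in K_{n,n}, each consistent with b, with |M'| ≥ 2. Let K = ⋂_{M ∈ M'} V(M), and let D be the set of edges (u,v) ∈ L × R with u ∈ K, v ∈ K and b(u) = b(v). If, for x sampled uniformly among subsets of L ⊕ R, the probability that there exists M ∈ M' with V(M) \ K ⊆ x is strictly greater than 1/2, then ⋂_{M ∈ M'} M = D. -/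
theorem inl_mem_endpoints {n : ℕ} {M : Finset (Fin n × Fin n)} {u : Fin n} :
    Sum.inl u ∈ endpoints M ↔ ∃ e ∈ M, e.1 = u := by
  simp [endpoints]

theorem inr_mem_endpoints {n : ℕ} {M : Finset (Fin n × Fin n)} {v : Fin n} :
    Sum.inr v ∈ endpoints M ↔ ∃ e ∈ M, e.2 = v := by
  simp [endpoints]

/-- In a matching consistent with `b`, two covered vertices on opposite sides form an edge of the
matching exactly when they share a label. -/
theorem ConsistentWith.mem_iff {n ℓ : ℕ} {M : Finset (Fin n × Fin n)}
    {b : Fin n ⊕ Fin n → Fin ℓ} (hM : ConsistentWith M b) (e : Fin n × Fin n) :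
    e ∈ M ↔ Sum.inl e.1 ∈ endpoints M ∧ Sum.inr e.2 ∈ endpoints M ∧
      b (Sum.inl e.1) = b (Sum.inr e.2) := by
  rw [inl_mem_endpoints, inr_mem_endpoints]
  constructor
  · exact fun he => ⟨⟨e, he, rfl⟩, ⟨e, he, rfl⟩, hM.1 e he⟩
  · obtain ⟨u, v⟩ := e
    rintro ⟨⟨f, hf, rfl⟩, ⟨g, hg, rfl⟩, hb⟩
    have hfg : f = g := by
      by_contra hne
      exact hM.2 f hf g hg hne (hb.trans (hM.1 g hg).symm)
    subst hfg
    exact hf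

/-- Let `𝓜'` be a family of `ℓ`-matchings, each consistent with `b`, with `|𝓜'| ≥ 2`, let
`K = ⋂_{M ∈ 𝓜'} V(M)`, and let `D` be the set of edges with both endpoints in `K` sharing the
same label. If, over a uniform subset `x` of `L ⊕ R`, the probability that some `M ∈ 𝓜'`
has `V(M) \ K ⊆ x` exceeds `1/2`, then `⋂_{M ∈ 𝓜'} M = D`. -/
theorem core_eq_blockMatching (n ℓ : ℕ) (b : Fin n ⊕ Fin n → Fin ℓ)
    (𝓜' : Finset (Finset (Fin n × Fin n)))
    (h𝓜' : ∀ M ∈ 𝓜', IsMatching M ∧ M.card = ℓ ∧ ConsistentWith M b)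
    (hcard : 2 ≤ 𝓜'.card)
    (K : Finset (Fin n ⊕ Fin n)) (hK : K = 𝓜'.inf endpoints)
    (D : Finset (Fin n × Fin n))
    (hD : D = Finset.univ.filter (fun e : Fin n × Fin n =>
      Sum.inl e.1 ∈ K ∧ Sum.inr e.2 ∈ K ∧ b (Sum.inl e.1) = b (Sum.inr e.2)))
    (hprob : (1 : ℝ) / 2 <
      (Nat.card {x : Finset (Fin n ⊕ Fin n) //
          ∃ M ∈ 𝓜', endpoints M \ K ⊆ x} : ℝ) / (2 : ℝ) ^ (2 * n)) :
    𝓜'.inf id = D := by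
  obtain ⟨M₀, hM₀⟩ : 𝓜'.Nonempty := Finset.card_pos.mp (by omega)
  subst hK hD
  ext e
  simp only [Finset.mem_inf, id, Finset.mem_filter, Finset.mem_univ, true_and]
  constructor
  · intro h
    have hiff M (hM : M ∈ 𝓜') := ((h𝓜' M hM).2.2.mem_iff e).mp (h M hM)
    exact ⟨fun M hM => (hiff M hM).1, fun M hM => (hiff M hM).2.1, (hiff M₀ hM₀).2.2⟩
  · rintro ⟨hu, hv, hb⟩ M hM
    exact ((h𝓜' M hM).2.2.mem_iff e).mpr ⟨hu M hM, hv M hM, hb⟩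
end
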